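/- Let G be a measurement model satisfying graphical condition (c), with 𝓘 the complete family of intervention targets, and let I ∈ 𝓘. Then two distinct hidden vertices h and h′ are d-separated given the empty set in G^(I) if and only if there is no maximal clique C of UDG(G^(I)) with ch(h) ∪ ch(h′) ⊆ C. -/

import Mathlib

universe u

/-- Acyclicity of a directed graph given by its edge relation. -/
def IsDAG {V : Type u} (E : V → V → Prop) : Prop :=
  ∀ v : V, ¬ Relation.TransGen E v v

/-- Hard intervention with target set `I`: delete every edge whose head lies in `I`. -/
def intervene {V : Type u} (E : V → V → Prop) (I : Set V) : V → V → Prop :=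
  fun u v => E u v ∧ v ∉ I

/-- Activity condition at an interior vertex `v` of a path, with neighbours `u` and `w`:
if `v` is a collider (both path edges point into `v`) then `v` or one of its directed
descendants must lie in `C`; otherwise `v` must not lie in `C`. -/
def ActiveTriple {V : Type u} (E : V → V → Prop) (C : Set V) (u v w : V) : Prop :=
  ((E u v ∧ E w v) → ∃ d, Relation.ReflTransGen E v d ∧ d ∈ C) ∧
  (¬ (E u v ∧ E w v) → v ∉ C)

/-- Every interior vertex of the vertex list satisfies the activity condition. -/
def TriplesActive {V : Type u} (E : V → V → Prop) (C : Set V) : List V → Prop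
  | u :: v :: w :: rest => ActiveTriple E C u v w ∧ TriplesActive E C (v :: w :: rest)
  | _ => True

/-- `p` is an active path between `a` and `b` given the conditioning set `C`. -/
def IsActivePath {V : Type u} (E : V → V → Prop) (C : Set V) (p : List V) (a b : V) : Prop :=
  p.Nodup ∧ p.head? = some a ∧ p.getLast? = some b ∧
  List.Chain' (fun u v => E u v ∨ E v u) p ∧ TriplesActive E C p

/-- Two single vertices are d-connected given `C`. -/
def dconn {V : Type u} (E : V → V → Prop) (C : Set V) (a b : V) : Prop :=
  ∃ p : List V, IsActivePath E C p a b

/-- Two single vertices are d-separated given `C`. -/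
def dsepV {V : Type u} (E : V → V → Prop) (C : Set V) (a b : V) : Prop :=
  ¬ dconn E C a b

/-- Vertex sets `A` and `B` are d-separated given `C`. -/
def dsep {V : Type u} (E : V → V → Prop) (A B C : Set V) : Prop :=
  ∀ a ∈ A, ∀ b ∈ B, dsepV E C a b

/-- `𝒯(G)`: the set of d-separation triples of pairwise disjoint vertex sets. -/
def Tsep {V : Type u} (E : V → V → Prop) : Set (Set V × Set V × Set V) :=
  { t | Disjoint t.1 t.2.1 ∧ Disjoint t.1 t.2.2 ∧ Disjoint t.2.1 t.2.2 ∧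
        dsep E t.1 t.2.1 t.2.2 }

/-- An edge `u → v` is isolated: `u` has no parents and the only parent of `v` is `u`. -/
def IsolatedEdge {V : Type u} (E : V → V → Prop) (u v : V) : Prop :=
  E u v ∧ (∀ w, ¬ E w u) ∧ (∀ w, E w v → w = u)

/-- The graph obtained by reversing the edge `u → v`. -/
def reverseEdge {V : Type u} (E : V → V → Prop) (u v : V) : V → V → Prop :=
  fun a b => (E a b ∧ ¬ (a = u ∧ b = v)) ∨ (a = v ∧ b = u)

/-- One step of isolated-edge reversal between DAGs. -/
def IsoStep {V : Type u} (E₁ E₂ : V → V → Prop) : Prop :=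
  IsDAG E₁ ∧ IsDAG E₂ ∧ ∃ u v, IsolatedEdge E₁ u v ∧ E₂ = reverseEdge E₁ u v

/-- Isolated equivalence: a finite sequence of isolated-edge reversals,
each intermediate graph being a DAG. -/
def IsoEquiv {V : Type u} (E₁ E₂ : V → V → Prop) : Prop :=
  Relation.ReflTransGen IsoStep E₁ E₂

/-- An edge `u → v` is covered: `pa(v) = pa(u) ∪ {u}`. -/
def CoveredEdge {V : Type u} (E : V → V → Prop) (u v : V) : Prop :=
  E u v ∧ ∀ w, E w v ↔ (E w u ∨ w = u)

/-- `p` is a directed path from `a` to `b`. -/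
def IsDirPath {V : Type u} (E : V → V → Prop) (p : List V) (a b : V) : Prop :=
  p.Nodup ∧ p.head? = some a ∧ p.getLast? = some b ∧ List.Chain' E p

/-- A measurement model on observed vertices `Xs` and hidden vertices `Hs`:
a DAG in which every edge goes from a hidden vertex to an observed or hidden one
(so observed vertices have no outgoing edges and all their parents are hidden). -/
def IsMeasurementModel {V : Type u} (E : V → V → Prop) (Xs Hs : Set V) : Prop :=
  IsDAG E ∧ Disjoint Xs Hs ∧ ∀ u v, E u v → u ∈ Hs ∧ (v ∈ Xs ∨ v ∈ Hs)

/-- Observed children of a hidden vertex. -/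
def chSet {V : Type u} (E : V → V → Prop) (Xs : Set V) (h : V) : Set V :=
  {x | x ∈ Xs ∧ E h x}

/-- Undirected dependency graph on `Xs`: distinct observed vertices are adjacent iff
they are d-connected given the empty set. -/
def UDG {V : Type u} (E : V → V → Prop) (Xs : Set V) : V → V → Prop :=
  fun x x' => x ∈ Xs ∧ x' ∈ Xs ∧ x ≠ x' ∧ dconn E ∅ x x'

/-- `C` is a clique of the undirected graph `R` on vertex set `Xs`. -/
def IsCliqueIn {V : Type u} (R : V → V → Prop) (Xs C : Set V) : Prop :=
  C ⊆ Xs ∧ ∀ x ∈ C, ∀ y ∈ C, x ≠ y → R x y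

/-- `C` is an inclusion-maximal clique of `R` on `Xs`. -/
def IsMaxCliqueIn {V : Type u} (R : V → V → Prop) (Xs C : Set V) : Prop :=
  IsCliqueIn R Xs C ∧ ∀ C', IsCliqueIn R Xs C' → C ⊆ C' → C = C'

/-- The complete family of intervention targets `𝓘 = {∅} ∪ {{h} : h ∈ H}`. -/
def completeFamily {V : Type u} (Hs : Set V) : Set (Set V) :=
  insert ∅ ((fun h => ({h} : Set V)) '' Hs)

/-- `Ω_G^(I)`: the set of maximal cliques of `UDG(G^(I))`. -/
def maxCliques {V : Type u} (E : V → V → Prop) (Xs I : Set V) : Set (Set V) :=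
  {C | IsMaxCliqueIn (UDG (intervene E I) Xs) Xs C}

/-- `Ω = ⋃_{I ∈ 𝓘} Ω_G^(I)`. -/
def Omega {V : Type u} (E : V → V → Prop) (Xs Hs : Set V) : Set (Set V) :=
  ⋃ I ∈ completeFamily Hs, maxCliques E Xs I

/-- A valid subset of the observed vertices. -/
def ValidSubset {V : Type u} (E : V → V → Prop) (Xs Hs X' : Set V) : Prop :=
  X' ⊆ Xs ∧ ∀ I ∈ completeFamily Hs, ∃ C ∈ maxCliques E Xs I, X' ⊆ C

/-- A maximal valid subset. -/
def MaxValidSubset {V : Type u} (E : V → V → Prop) (Xs Hs X' : Set V) : Prop :=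
  ValidSubset E Xs Hs X' ∧
  ¬ ∃ X'', ValidSubset E Xs Hs X'' ∧ X' ⊂ X'' ∧
      ∀ C ∈ Omega E Xs Hs, X' ⊆ C → X'' ⊆ C

/-- An imaginary subset: a maximal valid subset not contained in the child set of
any hidden vertex. -/
def ImaginarySubset {V : Type u} (E : V → V → Prop) (Xs Hs X' : Set V) : Prop :=
  MaxValidSubset E Xs Hs X' ∧ ¬ ∃ h ∈ Hs, X' ⊆ chSet E Xs h

/-- A replaceable subset: a maximal valid subset strictly contained in another
maximal valid subset. -/
def ReplaceableSubset {V : Type u} (E : V → V → Prop) (Xs Hs X' : Set V) : Prop :=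
  MaxValidSubset E Xs Hs X' ∧ ∃ X'', MaxValidSubset E Xs Hs X'' ∧ X' ⊂ X''

/-- Graphical condition (c). -/
def CondC {V : Type u} (E : V → V → Prop) (Xs Hs : Set V) : Prop :=
  ∀ I ∈ completeFamily Hs, ∀ h ∈ Hs, ∀ h' ∈ Hs, h ≠ h' →
    dsepV (intervene E I) ∅ h h' →
    ∃ x ∈ chSet E Xs h, ∃ x' ∈ chSet E Xs h', dsepV (intervene E I) ∅ x x'

/-- Add an edge `a → b` to a graph. -/
def addEdge {V : Type u} (E : V → V → Prop) (a b : V) : V → V → Prop :=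
  fun u v => E u v ∨ (u = a ∧ v = b)

/-- Graphical maximality of a measurement model. -/
def GraphMaximal {V : Type u} (E : V → V → Prop) (Xs Hs : Set V) : Prop :=
  (∀ x ∈ Xs, ∃ v, E v x) ∧
  ∀ h ∈ Hs, ∀ x ∈ Xs, ¬ E h x →
    ∃ I ∈ completeFamily Hs,
      UDG (intervene (addEdge E h x) I) Xs ≠ UDG (intervene E I) Xs

/-- A clique `C` is shattered by a collection `S` if some subcollection of `S`
has union exactly `C`. -/
def Shattered {V : Type u} (S : Set (Set V)) (C : Set V) : Prop :=
  ∃ S' ⊆ S, C = ⋃₀ S'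

/-- A complete collection of maximal valid subsets: for every intervention target,
every edge of the UDG has both endpoints in some shattered maximal clique. -/
def CompleteCollection {V : Type u} (E : V → V → Prop) (Xs Hs : Set V)
    (S : Set (Set V)) : Prop :=
  (∀ s ∈ S, MaxValidSubset E Xs Hs s) ∧
  ∀ I ∈ completeFamily Hs, ∀ x x' : V, UDG (intervene E I) Xs x x' →
    ∃ C ∈ maxCliques E Xs I, x ∈ C ∧ x' ∈ C ∧ Shattered S C

/-- A fractured subset. -/
def FracturedSubset {V : Type u} (E : V → V → Prop) (Xs Hs X' : Set V) : Prop :=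
  MaxValidSubset E Xs Hs X' ∧
  ∃ S, CompleteCollection E Xs Hs S ∧ ∀ s ∈ S, ¬ s ⊆ X'

/-- The pure-child assumption. -/
def PureChild {V : Type u} (E : V → V → Prop) (Xs Hs : Set V) : Prop :=
  ∀ h ∈ Hs, ∃ x ∈ Xs, E h x ∧ ∀ w, E w x → w = h

/-- The latent DAG: the induced directed graph on the hidden vertices. -/
def latentGraph {V : Type u} (E : V → V → Prop) (Hs : Set V) : V → V → Prop :=
  fun u v => u ∈ Hs ∧ v ∈ Hs ∧ E u v

/-- A common-parent path `x1 ← h → x2`. -/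
def IsCPPath {V : Type u} (p : List V) (x1 x2 : V) : Prop :=
  ∃ h, p = [x1, h, x2]

/-- A sparse measurement model. -/
def SparseMM {V : Type u} (E : V → V → Prop) (Xs Hs : Set V) : Prop :=
  (∀ x1 ∈ Xs, ∀ x2 ∈ Xs, x1 ≠ x2 → dconn E ∅ x1 x2 →
    (∀ h ∈ Hs, ∀ h' ∈ Hs,
        x1 ∈ chSet E Xs h → x2 ∈ chSet E Xs h →
        x1 ∈ chSet E Xs h' → x2 ∈ chSet E Xs h' → h = h') ∧
    (∀ p q : List V,
        IsActivePath E ∅ p x1 x2 → ¬ IsCPPath p x1 x2 →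
        IsActivePath E ∅ q x1 x2 → ¬ IsCPPath q x1 x2 → p = q)) ∧
  (∀ x1 ∈ Xs, ∀ x2 ∈ Xs, ∀ x3 ∈ Xs, ∀ h2 ∈ Hs, ∀ h3 ∈ Hs, h2 ≠ h3 →
    x1 ∈ chSet E Xs h2 → x2 ∈ chSet E Xs h2 →
    x1 ∈ chSet E Xs h3 → x3 ∈ chSet E Xs h3 →
    ∀ p : List V, IsActivePath E ∅ p x2 x3 →
      ¬ IsCPPath p x2 x3 ∧ p[1]? = some h2 ∧ p.reverse[1]? = some h3)

theorem IsDAG.intervene {V : Type u} {E : V → V → Prop} (hE : IsDAG E) (I : Set V) :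
    IsDAG (intervene E I) :=
  fun v hv => hE v (Relation.TransGen.mono (fun _ _ h => h.1) _ _ hv)

theorem IsDAG.asymm {V : Type u} {E : V → V → Prop} (hE : IsDAG E) {a b : V}
    (hab : E a b) : ¬ E b a :=
  fun hba => hE a (.tail (.single hab) hba)

theorem TriplesActive.tail {V : Type u} {E : V → V → Prop} {C : Set V} {a : V} {l : List V}
    (h : TriplesActive E C (a :: l)) : TriplesActive E C l := by
  match l, h with
  | [], _ => trivial
  | [_], _ => trivial
  | _ :: _ :: _, h => exact h.2

theorem TriplesActive.of_append_right {V : Type u} {E : V → V → Prop} {C : Set V}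
    (s : List V) {l : List V} (h : TriplesActive E C (s ++ l)) : TriplesActive E C l := by
  induction s with
  | nil => exact h
  | cons a s ih => exact ih h.tail

/-- A vertex on an active path is d-connected to its endpoint. -/
theorem IsActivePath.dconn_of_mem {V : Type u} {E : V → V → Prop} {C : Set V} {p : List V}
    {a b v : V} (hp : IsActivePath E C p a b) (hv : v ∈ p) :
    dconn E C v b := by
  obtain ⟨s, t, rfl⟩ := List.append_of_mem hv
  obtain ⟨hnd, -, hlast, hchain, htri⟩ := hp
  exact ⟨v :: t, (List.nodup_append.1 hnd).2.1, rfl, by simpa using hlast,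
    hchain.suffix (List.suffix_append _ _), htri.of_append_right⟩

theorem dconn_empty_child_left {V : Type u} {E : V → V → Prop} (hE : IsDAG E) {a a' b : V}
    (h : dconn E ∅ a b) (ha : E a a') : dconn E ∅ a' b := by
  obtain ⟨p, hp⟩ := h
  by_cases hmem : a' ∈ p
  · exact hp.dconn_of_mem hmem
  · obtain ⟨hnd, hhead, hlast, hchain, htri⟩ := hp
    match p, hhead with
    | a :: l, rfl =>
      refine ⟨a' :: a :: l, List.nodup_cons.2 ⟨hmem, hnd⟩, rfl, by simpa using hlast,
        List.isChain_cons_cons.2 ⟨Or.inr ha, hchain⟩, ?_⟩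
      match l, htri with
      | [], _ => trivial
      | _ :: _, htri =>
        exact ⟨⟨fun h => (hE.asymm ha h.1).elim, fun _ => Set.notMem_empty _⟩, htri⟩

theorem IsDAG.triplesActive_empty {V : Type u} {E : V → V → Prop} (hE : IsDAG E) :
    ∀ {p : List V}, List.IsChain E p → TriplesActive E ∅ p
  | [], _ => trivial
  | [_], _ => trivial
  | [_, _], _ => trivial
  | _ :: _ :: _ :: _, h => by
    rw [List.isChain_cons_cons] at h
    exact ⟨⟨fun hc => (hE.asymm hc.2 (List.isChain_cons_cons.1 h.2).1).elim,
      fun _ => Set.notMem_empty _⟩, hE.triplesActive_empty h.2⟩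

theorem exists_isDirPath {V : Type u} {E : V → V → Prop} {a b : V}
    (h : Relation.ReflTransGen E a b) : ∃ p, IsDirPath E p a b := by
  induction h using Relation.ReflTransGen.head_induction_on with
  | refl => exact ⟨[b], by simp [IsDirPath, List.Chain']⟩
  | @head a c hac _ ih =>
    obtain ⟨p, hnd, hhead, hlast, hchain⟩ := ih
    by_cases hmem : a ∈ p
    · obtain ⟨s, t, rfl⟩ := List.append_of_mem hmem
      exact ⟨a :: t, (List.nodup_append.1 hnd).2.1, rfl, by simpa using hlast,
        hchain.suffix (List.suffix_append _ _)⟩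
    · match p, hhead with
      | c :: l, rfl =>
        exact ⟨a :: c :: l, List.nodup_cons.2 ⟨hmem, hnd⟩, rfl, by simpa using hlast,
          List.isChain_cons_cons.2 ⟨hac, hchain⟩⟩

theorem dconn_empty_of_common_ancestor {V : Type u} {E : V → V → Prop} (hE : IsDAG E)
    {a b c : V} (ha : Relation.ReflTransGen E c a) (hb : Relation.ReflTransGen E c b) :
    dconn E ∅ a b := by
  induction ha with
  | refl =>
    obtain ⟨p, hnd, hhead, hlast, hchain⟩ := exists_isDirPath hb
    exact ⟨p, hnd, hhead, hlast, hchain.imp fun _ _ => Or.inl, hE.triplesActive_empty hchain⟩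
  | tail _ h ih => exact dconn_empty_child_left hE ih h

/-- On a collider-free path, the endpoints have a common ancestor, which is the first vertex
if the path starts with a forward edge. -/
theorem common_ancestor_of_triplesActive {V : Type u} {E : V → V → Prop} {b : V} :
    ∀ (l : List V) (a : V), (a :: l).getLast? = some b →
      List.IsChain (fun u v => E u v ∨ E v u) (a :: l) → TriplesActive E ∅ (a :: l) →
      (∃ c, Relation.ReflTransGen E c a ∧ Relation.ReflTransGen E c b) ∧
        ∀ v ∈ l.head?, E a v → Relation.ReflTransGen E a b
  | [], a, hlast, _, _ => by
    obtain rfl : a = b := by simpa using hlast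
    exact ⟨⟨a, .refl, .refl⟩, by simp⟩
  | v :: l, a, hlast, hchain, htri => by
    rw [List.isChain_cons_cons] at hchain
    have hlast' : (v :: l).getLast? = some b := by simpa using hlast
    obtain ⟨⟨c, hcv, hcb⟩, hfwd⟩ :=
      common_ancestor_of_triplesActive l v hlast' hchain.2 htri.tail
    have hdir : E a v → Relation.ReflTransGen E a b := by
      intro hav
      refine .head hav ?_
      match l, hlast', hchain, htri, hfwd with
      | [], hlast', _, _, _ =>
        obtain rfl : v = b := by simpa using hlast'
        exact .refl
      | w :: l, _, hchain, htri, hfwd =>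
        refine hfwd w rfl ((List.isChain_cons_cons.1 hchain.2).1.resolve_right fun hwv => ?_)
        obtain ⟨d, -, hd⟩ := htri.1.1 ⟨hav, hwv⟩
        exact hd
    refine ⟨?_, fun w hw => ?_⟩
    · rcases hchain.1 with hav | hva
      · exact ⟨a, .refl, hdir hav⟩
      · exact ⟨c, hcv.tail hva, hcb⟩
    · obtain rfl : v = w := by simpa using hw
      exact hdir

theorem dconn_empty_iff {V : Type u} {E : V → V → Prop} (hE : IsDAG E) {a b : V} :
    dconn E ∅ a b ↔ ∃ c, Relation.ReflTransGen E c a ∧ Relation.ReflTransGen E c b := by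
  refine ⟨?_, fun ⟨c, ha, hb⟩ => dconn_empty_of_common_ancestor hE ha hb⟩
  rintro ⟨p, -, hhead, hlast, hchain, htri⟩
  match p, hhead with
  | a :: l, rfl => exact (common_ancestor_of_triplesActive l a hlast hchain htri).1

theorem IsCliqueIn.exists_isMaxCliqueIn {V : Type u} [Finite V] {R : V → V → Prop}
    {Xs K : Set V} (hK : IsCliqueIn R Xs K) : ∃ C, IsMaxCliqueIn R Xs C ∧ K ⊆ C := by
  obtain ⟨C, hKC, hC⟩ := (Set.toFinite {C | IsCliqueIn R Xs C}).exists_le_maximal hK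
  exact ⟨C, ⟨hC.1, fun _ hC' hle => hle.antisymm (hC.2 hC' hle)⟩, hKC⟩

theorem IsMeasurementModel.intervene_of_mem_chSet {V : Type u} {E : V → V → Prop}
    {Xs Hs I : Set V} (hmm : IsMeasurementModel E Xs Hs) (hI : I ∈ completeFamily Hs)
    {h x : V} (hx : x ∈ chSet E Xs h) : intervene E I h x := by
  refine ⟨hx.2, fun hxI => ?_⟩
  rcases hI with rfl | ⟨k, hk, rfl⟩
  · exact hxI
  · obtain rfl : x = k := hxI
    exact Set.disjoint_left.1 hmm.2.1 hx.1 hk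

/-- In a measurement model satisfying condition (c), for any target
`I` of the complete family, two distinct hidden vertices are d-separated given the empty
set in `G^(I)` iff no maximal clique of `UDG(G^(I))` contains `ch(h) ∪ ch(h')`. -/
theorem statement14 {V : Type u} [Fintype V] (E : V → V → Prop) (Xs Hs : Set V)
    (hmm : IsMeasurementModel E Xs Hs) (hc : CondC E Xs Hs)
    (I : Set V) (hI : I ∈ completeFamily Hs)
    (h h' : V) (hh : h ∈ Hs) (hh' : h' ∈ Hs) (hne : h ≠ h') :
    dsepV (intervene E I) ∅ h h' ↔
      ¬ ∃ C : Set V, IsMaxCliqueIn (UDG (intervene E I) Xs) Xs C ∧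
          chSet E Xs h ∪ chSet E Xs h' ⊆ C := by
  have hE := hmm.1.intervene I
  constructor
  · rintro hsep ⟨C, hC, hsub⟩
    obtain ⟨x, hx, x', hx', hxx'⟩ := hc I hI h hh h' hh' hne hsep
    have hxne : x ≠ x' := by
      rintro rfl
      exact hxx' ((dconn_empty_iff hE).2 ⟨x, .refl, .refl⟩)
    exact hxx' (hC.1.2 x (hsub (.inl hx)) x' (hsub (.inr hx')) hxne).2.2.2
  · intro hno hconn
    obtain ⟨c, hch, hch'⟩ := (dconn_empty_iff hE).1 hconn
    have hanc : ∀ x ∈ chSet E Xs h ∪ chSet E Xs h',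
        x ∈ Xs ∧ Relation.ReflTransGen (intervene E I) c x := by
      rintro x (hx | hx)
      · exact ⟨hx.1, hch.tail (hmm.intervene_of_mem_chSet hI hx)⟩
      · exact ⟨hx.1, hch'.tail (hmm.intervene_of_mem_chSet hI hx)⟩
    refine hno (IsCliqueIn.exists_isMaxCliqueIn ⟨fun x hx => (hanc x hx).1, ?_⟩)
    intro x hx y hy hxy
    exact ⟨(hanc x hx).1, (hanc y hy).1, hxy,
      dconn_empty_of_common_ancestor hE (hanc x hx).2 (hanc y hy).2⟩
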